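/- arXiv:1006.3867 — 2 statements merged into one kernel-verified Lean document; each statement's English description precedes it below -/
import Mathlib

section
/- Suppose that log N(T,d,ε) ≥ c ε^{-a} for some a > 0, c > 0 and all sufficiently small ε > 0, and set 1/q' = 1 − 1/q. Then there is a constant c' > 0 such that for all n ≥ 2: if a < q' then e_n(V_{α,σ} : ℓ_1(T) → ℓ_q(T)) ≥ c' n^{-1/q'} (log n)^{1/q' − 1/a}, and if a ≥ q' then e_n(V_{α,σ}) ≥ c' n^{-1/a}. -/
open scoped ENNReal NNReal
open MeasureTheory

noncomputable section

/-- A rooted tree structure on a partially ordered type with bottom element (the root):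
the set of ancestors of any node is finite and totally ordered, and every node has
finitely many offspring (covering elements). -/
def IsTree (T : Type) [PartialOrder T] [OrderBot T] : Prop :=
  (∀ s : T, (Set.Iic s).Finite) ∧
  (∀ s a b : T, a ≤ s → b ≤ s → a ≤ b ∨ b ≤ a) ∧
  (∀ t : T, {s : T | t ⋖ s}.Finite)

/-- The binary tree: a rooted tree in which every node has exactly two offspring. -/
def IsBinaryTree (T : Type) [PartialOrder T] [OrderBot T] : Prop :=
  IsTree T ∧ ∀ t : T, Nat.card {s : T | t ⋖ s} = 2

/-- `glb` assigns to any two nodes their greatest common ancestor. -/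
def IsGCA {T : Type} [PartialOrder T] (glb : T → T → T) : Prop :=
  ∀ t s : T, glb t s ≤ t ∧ glb t s ≤ s ∧ ∀ u : T, u ≤ t → u ≤ s → u ≤ glb t s

/-- The generation `|t|` of a node: the number of its strict ancestors. -/
def gen {T : Type} [PartialOrder T] (t : T) : ℕ := Nat.card (Set.Iio t)

/-- The distance `max_{t ≺ v ⪯ s} (∑_{t ≺ r ⪯ v} α(r)^q)^{1/q} σ(v)` along a branch. -/
def dOrd {T : Type} [PartialOrder T] (q : ℝ) (α σ : T → ℝ) (t s : T) : ℝ :=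
  sSup ((fun v => (∑ᶠ r ∈ Set.Ioc t v, α r ^ q) ^ (1 / q) * σ v) '' Set.Ioc t s)

/- The tree metric `d`, extended by symmetry and via greatest common ancestors. -/
open Classical in
def treeDist {T : Type} [PartialOrder T] (q : ℝ) (α σ : T → ℝ)
    (glb : T → T → T) (t s : T) : ℝ :=
  if t ≤ s then dOrd q α σ t s
  else if s ≤ t then dOrd q α σ s t
  else dOrd q α σ (glb t s) t + dOrd q α σ (glb t s) s

/-- `N(T,d,ε)`: minimal number of open `ε`-balls needed to cover `T` (`∞` if none). -/
def coveringNumber {T : Type} (d : T → T → ℝ) (ε : ℝ) : ℝ≥0∞ :=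
  ⨅ S ∈ {S : Finset T | ∀ t : T, ∃ s ∈ S, d s t < ε}, (S.card : ℝ≥0∞)

/-- `Ñ(T,d,ε)`: minimal cardinality of an order `ε`-net of `T`. -/
def orderCoveringNumber {T : Type} [PartialOrder T] (d : T → T → ℝ) (ε : ℝ) : ℝ≥0∞ :=
  ⨅ S ∈ {S : Finset T | ∀ t : T, ∃ s ∈ S, s ≤ t ∧ d s t < ε}, (S.card : ℝ≥0∞)

/-- Minimal number of open `ε`-balls of a normed space needed to cover the set `A`. -/
def setCoveringNumber {Y : Type} [NormedAddCommGroup Y] (A : Set Y) (ε : ℝ) : ℝ≥0∞ :=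
  ⨅ F ∈ {F : Finset Y | ∀ a ∈ A, ∃ y ∈ F, ‖a - y‖ < ε}, (F.card : ℝ≥0∞)

/-- The dyadic entropy numbers `e_n(V)` of an operator `V`. -/
def entropyNumber {X Y : Type} [NormedAddCommGroup X] [NormedSpace ℝ X]
    [NormedAddCommGroup Y] [NormedSpace ℝ Y] (n : ℕ) (V : X →L[ℝ] Y) : ℝ :=
  sInf {ε : ℝ | 0 < ε ∧ ∃ F : Finset Y, F.card ≤ 2 ^ (n - 1) ∧
    ∀ x : X, ‖x‖ ≤ 1 → ∃ y ∈ F, ‖V x - y‖ < ε}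

/-- The space `ℓ₁(T)`. -/
abbrev ellOne (T : Type) := lp (fun _ : T => ℝ) 1

/-- The space `ℓ_q(T)`. -/
abbrev ellQ (T : Type) (q : ℝ) := lp (fun _ : T => ℝ) (ENNReal.ofReal q)


/-- The `q`-th power of the branch weight `(∑_{t ≺ r ⪯ v} α(r)^q)^{1/q} σ(v)`. -/
def branchWeight {T : Type} [PartialOrder T] (q : ℝ) (α σ : T → ℝ) (t v : T) : ℝ :=
  (∑ᶠ r ∈ Set.Ioc t v, α r ^ q) * σ v ^ q

/-- A family of pairwise disjoint order intervals `(t i, v i]` of weight at least `δ`, each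
minimal with this property among the intervals with the same lower end point. -/
structure IsHeavyFamily {T ι : Type} [PartialOrder T] (W : T → T → ℝ) (δ : ℝ)
    (t v : ι → T) : Prop where
  le_weight : ∀ i, δ ≤ W (t i) (v i)
  weight_lt : ∀ i, ∀ u ∈ Set.Ioo (t i) (v i), W (t i) u < δ
  disjoint : Pairwise fun i j => Disjoint (Set.Ioc (t i) (v i)) (Set.Ioc (t j) (v j))

/-- Below any node `x` there is a greatest node satisfying a predicate that holds at the root. -/
lemma IsTree.exists_greatest_below {T : Type} [PartialOrder T] [OrderBot T] (hT : IsTree T)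
    (p : T → Prop) (hp : p ⊥) (x : T) : ∃ c ≤ x, p c ∧ ∀ y ≤ x, p y → y ≤ c := by
  obtain ⟨c, hc⟩ := Set.Finite.exists_maximal (s := {c | c ≤ x ∧ p c})
    ((hT.1 x).subset fun y hy => hy.1) ⟨⊥, bot_le, hp⟩
  refine ⟨c, hc.prop.1, hc.prop.2, fun y hy hpy => ?_⟩
  rcases hT.2.1 x y c hy hc.prop.1 with h | h
  · exact h
  · exact hc.le_of_ge ⟨hy, hpy⟩ h

/-- The end points of a maximal heavy family and the greatest common ancestors of its upper
end points form an order net. -/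
lemma IsHeavyFamily.exists_net_of_maximal {T : Type} [PartialOrder T] [OrderBot T]
    (hT : IsTree T) {glb : T → T → T} (hglb : IsGCA glb) {W : T → T → ℝ} {δ : ℝ} (hδ : 0 < δ)
    (hanti : ∀ ⦃t s v⦄, t ≤ s → W s v ≤ W t v)
    (hadd : ∀ ⦃t s v⦄, t ≤ s → s ≤ v → W t v ≤ W t s + W s v)
    {k : ℕ} {t v : Fin k → T} (h : IsHeavyFamily W δ t v)
    (hmax : ∀ s u, δ ≤ W s u → ∃ i, ¬ Disjoint (Set.Ioc s u) (Set.Ioc (t i) (v i))) :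
    ∃ B : Finset T, B.card ≤ (k + 1) ^ 2 ∧
      ∀ x, ∃ b ∈ B, b ≤ x ∧ ∀ u ∈ Set.Ioc b x, W b u < 2 * δ := by
  classical
  let B : Finset T := insert ⊥ ((Finset.univ.image t ∪ Finset.univ.image v) ∪
    (Finset.univ : Finset (Fin k × Fin k)).image fun i => glb (v i.1) (v i.2))
  have ht : ∀ i, t i ∈ B := fun i => by simp [B]
  have hv : ∀ i, v i ∈ B := fun i => by simp [B]
  have hg : ∀ i j, glb (v i) (v j) ∈ B := fun i j => by
    refine Finset.mem_insert_of_mem (Finset.mem_union_right _ ?_)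
    exact Finset.mem_image.2 ⟨(i, j), Finset.mem_univ _, rfl⟩
  refine ⟨B, ?_, fun x => ?_⟩
  · have h1 : (Finset.univ.image t).card ≤ k := Finset.card_image_le.trans (by simp)
    have h2 : (Finset.univ.image v).card ≤ k := Finset.card_image_le.trans (by simp)
    have h3 : ((Finset.univ : Finset (Fin k × Fin k)).image
      fun i => glb (v i.1) (v i.2)).card ≤ k * k := Finset.card_image_le.trans (by simp)
    calc B.card ≤ ((k + k) + k * k) + 1 :=
          (Finset.card_insert_le _ _).trans (Nat.add_le_add_right ((Finset.card_union_le _ _).trans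
            (Nat.add_le_add ((Finset.card_union_le _ _).trans (Nat.add_le_add h1 h2)) h3)) 1)
      _ = (k + 1) ^ 2 := by ring
  · obtain ⟨c, hcx, hc, hcmax⟩ :=
      hT.exists_greatest_below (fun y => y = ⊥ ∨ ∃ i, y ≤ v i) (Or.inl rfl) x
    obtain ⟨b, hbc, hbB, hbmax⟩ :=
      hT.exists_greatest_below (· ∈ B) (Finset.mem_insert_self _ _) c
    have hlow : ∀ u ∈ Set.Ioc b c, W b u < δ := by
      intro u hu
      by_contra! hcon
      obtain ⟨i, hi⟩ := hmax b u hcon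
      obtain ⟨p, hp, hpi⟩ := Set.not_disjoint_iff.1 hi
      have hpc : p ≤ c := hp.2.trans hu.2
      obtain ⟨j, hj⟩ : ∃ j, c ≤ v j := by
        rcases hc with rfl | hj
        · exact absurd (hp.1.trans_le hpc) not_lt_bot
        · exact hj
      have htb : t i ≤ b := hbmax _ (hpi.1.le.trans hpc) (ht i)
      have hpg : p ≤ glb (v i) (v j) := (hglb _ _).2.2 p hpi.2 (hpc.trans hj)
      have hcv : c ≤ v i := by
        rcases hT.2.1 (v j) _ c (hglb (v i) (v j)).2.1 hj with hgc | hgc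
        · exact absurd (hp.1.trans_le (hpg.trans (hbmax _ hgc (hg i j)))) (lt_irrefl _)
        · exact hgc.trans (hglb _ _).1
      have hne : c ≠ v i := fun e =>
        absurd (hp.1.trans_le (hpi.2.trans (hbmax _ e.ge (hv i)))) (lt_irrefl _)
      have := h.weight_lt i u ⟨htb.trans_lt hu.1, hu.2.trans_lt (lt_of_le_of_ne hcv hne)⟩
      exact absurd (hcon.trans (hanti htb)) (not_le.2 this)
    have hhigh : ∀ u ∈ Set.Ioc c x, W c u < δ := by
      intro u hu
      by_contra! hcon
      obtain ⟨i, hi⟩ := hmax c u hcon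
      obtain ⟨p, hp, hpi⟩ := Set.not_disjoint_iff.1 hi
      exact absurd (hp.1.trans_le (hcmax p (hp.2.trans hu.2) (Or.inr ⟨i, hpi.2⟩))) (lt_irrefl _)
    refine ⟨b, hbB, hbc.trans hcx, fun u hu => ?_⟩
    by_cases huc : u ≤ c
    · linarith [hlow u ⟨hu.1, huc⟩]
    · have hcu : c < u := lt_of_le_not_ge ((hT.2.1 x u c hu.2 hcx).resolve_left huc) huc
      have h2 := hhigh u ⟨hcu, hu.2⟩
      rcases hbc.eq_or_lt with rfl | hlt
      · linarith
      · linarith [hadd hbc hcu.le, hlow c ⟨hlt, le_rfl⟩]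

/-- If no order net of cardinality at most `k ^ 2` exists, there is a heavy family of
cardinality `k`. -/
lemma exists_isHeavyFamily {T : Type} [PartialOrder T] [OrderBot T]
    (hT : IsTree T) {glb : T → T → T} (hglb : IsGCA glb) {W : T → T → ℝ} {δ : ℝ} (hδ : 0 < δ)
    (hanti : ∀ ⦃t s v⦄, t ≤ s → W s v ≤ W t v)
    (hadd : ∀ ⦃t s v⦄, t ≤ s → s ≤ v → W t v ≤ W t s + W s v)
    (hzero : ∀ ⦃t v⦄, ¬ t < v → W t v = 0) (k : ℕ)
    (hk : ∀ B : Finset T, B.card ≤ k ^ 2 →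
      ∃ x, ∀ b ∈ B, b ≤ x → ∃ u ∈ Set.Ioc b x, 2 * δ ≤ W b u) :
    ∃ t v : Fin k → T, IsHeavyFamily W δ t v := by
  induction k with
  | zero => exact ⟨Fin.elim0, Fin.elim0, fun i => i.elim0, fun i => i.elim0, fun i => i.elim0⟩
  | succ k ih =>
    obtain ⟨t, v, h⟩ := ih fun B hB => hk B (hB.trans (Nat.pow_le_pow_left k.le_succ 2))
    have hnot : ¬ ∀ s u, δ ≤ W s u → ∃ i, ¬ Disjoint (Set.Ioc s u) (Set.Ioc (t i) (v i)) := by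
      intro hmax
      obtain ⟨B, hB, hcov⟩ := h.exists_net_of_maximal hT hglb hδ hanti hadd hmax
      obtain ⟨x, hx⟩ := hk B hB
      obtain ⟨b, hb, hbx, hlt⟩ := hcov x
      obtain ⟨u, hu, hle⟩ := hx b hb hbx
      exact absurd (hlt u hu) (not_lt.2 hle)
    push Not at hnot
    obtain ⟨s, u, hsu, hdisj⟩ := hnot
    have hlt : s < u := by
      by_contra hcon
      rw [hzero hcon] at hsu
      exact absurd hδ (not_lt.2 hsu)
    obtain ⟨w, hw⟩ := Set.Finite.exists_minimal (s := {w | w ∈ Set.Ioc s u ∧ δ ≤ W s w})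
      ((hT.1 u).subset fun y hy => hy.1.2) ⟨u, ⟨hlt, le_rfl⟩, hsu⟩
    have hd : ∀ i, Disjoint (Set.Ioc s w) (Set.Ioc (t i) (v i)) := fun i =>
      (hdisj i).mono_left (Set.Ioc_subset_Ioc_right hw.prop.1.2)
    refine ⟨Fin.cons s t, Fin.cons w v, ?_, ?_, ?_⟩
    · intro i
      cases i using Fin.cases with
      | zero => simpa using hw.prop.2
      | succ i => simpa using h.le_weight i
    · intro i
      cases i using Fin.cases with
      | zero =>
        intro y hy
        simp only [Fin.cons_zero] at hy ⊢
        by_contra! hcon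
        exact absurd hy.2
          (hw.le_of_le ⟨⟨hy.1, hy.2.le.trans hw.prop.1.2⟩, hcon⟩ hy.2.le).not_gt
      | succ i => simpa using h.weight_lt i
    · intro i j hij
      cases i using Fin.cases with
      | zero =>
        cases j using Fin.cases with
        | zero => exact absurd rfl hij
        | succ j => simpa using hd j
      | succ i =>
        cases j using Fin.cases with
        | zero => simpa using (hd i).symm
        | succ j => simpa using h.disjoint (fun e => hij (congrArg Fin.succ e))

/-- Among all words of length `2 * k` over `4 * R` letters, coloured with fewer than `R ^ k`
colours, two of the same colour differ in at least `k` places. -/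
lemma exists_same_color_of_card_lt {C : Type} [DecidableEq C] (k R : ℕ) (F : Finset C)
    (hF : F.card < R ^ k) (φ : (Fin (2 * k) → Fin (4 * R)) → C) (hφ : ∀ f, φ f ∈ F) :
    ∃ f g, φ f = φ g ∧ k ≤ (Finset.univ.filter fun i => f i ≠ g i).card := by
  obtain ⟨y, -, hy⟩ := Finset.exists_lt_card_fiber_of_mul_lt_card_of_maps_to
    (s := Finset.univ) (t := F) (f := φ) (n := 4 ^ k * (4 * R) ^ k) (fun f _ => hφ f) (by
      have hpos : 0 < R ^ k := by omega
      rw [Finset.card_univ, Fintype.card_fun, Fintype.card_fin, Fintype.card_fin]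
      calc F.card * (4 ^ k * (4 * R) ^ k) < R ^ k * (4 ^ k * (4 * R) ^ k) :=
            Nat.mul_lt_mul_of_pos_right hF (by rw [mul_pow]; positivity)
        _ = (4 * R) ^ (2 * k) := by rw [two_mul, pow_add, mul_pow]; ring)
  by_contra! hcon
  obtain ⟨g, hg⟩ : (Finset.univ.filter fun f => φ f = y).Nonempty :=
    Finset.card_pos.1 (by omega)
  simp only [Finset.mem_filter, Finset.mem_univ, true_and] at hg
  let P : Finset (Fin (2 * k)) → Finset (Fin (2 * k) → Fin (4 * R)) := fun A =>
    Fintype.piFinset fun i => if i ∈ A then {g i} else Finset.univ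
  have hsub : (Finset.univ.filter fun f => φ f = y) ⊆
      (Finset.univ.powersetCard k).biUnion P := by
    intro f hf
    simp only [Finset.mem_filter, Finset.mem_univ, true_and] at hf
    have h1 := hcon f g (hf.trans hg.symm)
    simp only [ne_eq] at h1
    have h2 := Finset.card_filter_add_card_filter_not (s := Finset.univ) fun i => f i = g i
    rw [Finset.card_univ, Fintype.card_fin] at h2
    obtain ⟨A, hA, hAk⟩ := Finset.exists_subset_card_eq
      (s := Finset.univ.filter fun i => f i = g i) (n := k) (by omega)
    refine Finset.mem_biUnion.2 ⟨A, by simp [hAk], Fintype.mem_piFinset.2 fun i => ?_⟩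
    split_ifs with hi
    · simpa using (Finset.mem_filter.1 (hA hi)).2
    · exact Finset.mem_univ _
  have hP : ∀ A ∈ (Finset.univ : Finset (Fin (2 * k))).powersetCard k,
      (P A).card ≤ (4 * R) ^ k := by
    intro A hA
    have hA := (Finset.mem_powersetCard.1 hA).2
    have hAc : (Finset.univ.filter fun i => i ∉ A).card = k := by
      have := Finset.card_compl A
      rw [Fintype.card_fin] at this
      rw [show (Finset.univ.filter fun i => i ∉ A) = Aᶜ by ext; simp]
      omega
    rw [Fintype.card_piFinset]
    simp only [apply_ite Finset.card, Finset.card_singleton, Finset.card_univ, Fintype.card_fin]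
    rw [Finset.prod_ite]
    simp [hAc]
  have hcard := (Finset.card_le_card hsub).trans (Finset.card_biUnion_le_card_mul _ _ _ hP)
  rw [Finset.card_powersetCard, Finset.card_univ, Fintype.card_fin] at hcard
  have hch : (2 * k).choose k ≤ 4 ^ k := by
    calc (2 * k).choose k ≤ 2 ^ (2 * k) := Nat.choose_le_two_pow _ _
      _ = 4 ^ k := by rw [pow_mul]; norm_num
  exact absurd hy (not_lt.2 (hcard.trans (Nat.mul_le_mul_right _ hch)))

section BranchWeight

variable {T : Type} [PartialOrder T] {q : ℝ} {α σ : T → ℝ}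

lemma branchWeight_eq_zero_of_not_lt ⦃t v : T⦄ (h : ¬ t < v) : branchWeight q α σ t v = 0 := by
  simp [branchWeight, Set.Ioc_eq_empty h]

variable [OrderBot T]

lemma IsTree.finite_Ioc (hT : IsTree T) (t v : T) : (Set.Ioc t v).Finite :=
  (hT.1 v).subset fun _ hr => hr.2

lemma IsTree.finsum_Ioc_nonneg (hT : IsTree T) (hα : ∀ t, 0 < α t) (t v : T) :
    0 ≤ ∑ᶠ r ∈ Set.Ioc t v, α r ^ q := by
  rw [finsum_mem_eq_finite_toFinset_sum _ (hT.finite_Ioc t v)]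
  exact Finset.sum_nonneg fun r _ => Real.rpow_nonneg (hα r).le q

lemma branchWeight_antitone_left (hT : IsTree T) (hα : ∀ t, 0 < α t) (hσ : ∀ t, 0 < σ t)
    ⦃t s v : T⦄ (hts : t ≤ s) : branchWeight q α σ s v ≤ branchWeight q α σ t v := by
  refine mul_le_mul_of_nonneg_right ?_ (Real.rpow_nonneg (hσ v).le q)
  rw [finsum_mem_eq_finite_toFinset_sum _ (hT.finite_Ioc t v),
    finsum_mem_eq_finite_toFinset_sum _ (hT.finite_Ioc s v)]
  exact Finset.sum_le_sum_of_subset_of_nonneg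
    (Set.Finite.toFinset_subset_toFinset.2 (Set.Ioc_subset_Ioc_left hts))
    fun r _ _ => Real.rpow_nonneg (hα r).le q

lemma branchWeight_le_add (hT : IsTree T) (hq : 0 ≤ q) (hα : ∀ t, 0 < α t) (hσ : ∀ t, 0 < σ t)
    (hσmono : ∀ ⦃t s : T⦄, t ≤ s → σ s ≤ σ t) ⦃t s v : T⦄ (hts : t ≤ s) (hsv : s ≤ v) :
    branchWeight q α σ t v ≤ branchWeight q α σ t s + branchWeight q α σ s v := by
  have hunion : Set.Ioc t v = Set.Ioc t s ∪ Set.Ioc s v := by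
    ext r
    simp only [Set.mem_Ioc, Set.mem_union]
    refine ⟨fun hr => ?_, ?_⟩
    · by_cases hrs : r ≤ s
      · exact Or.inl ⟨hr.1, hrs⟩
      · exact Or.inr ⟨lt_of_le_not_ge ((hT.2.1 v r s hr.2 hsv).resolve_left hrs) hrs, hr.2⟩
    · rintro (hr | hr)
      · exact ⟨hr.1, hr.2.trans hsv⟩
      · exact ⟨hts.trans_lt hr.1, hr.2⟩
  have hdisj : Disjoint (Set.Ioc t s) (Set.Ioc s v) :=
    Set.disjoint_left.2 fun r hr hr' => absurd (hr'.1.trans_le hr.2) (lt_irrefl _)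
  unfold branchWeight
  rw [hunion, finsum_mem_union hdisj (hT.finite_Ioc t s) (hT.finite_Ioc s v), add_mul]
  gcongr
  · exact hT.finsum_Ioc_nonneg hα t s
  · exact (hσ v).le
  · exact hσmono hsv

/-- Weights below `2 * ε ^ q` on a branch give a branch distance below `2 * ε`. -/
lemma dOrd_lt_of_branchWeight_lt (hT : IsTree T) (hq : 1 < q) (hα : ∀ t, 0 < α t)
    (hσ : ∀ t, 0 < σ t) {ε : ℝ} (hε : 0 < ε) {b x : T}
    (h : ∀ u ∈ Set.Ioc b x, branchWeight q α σ b u < 2 * ε ^ q) : dOrd q α σ b x < 2 * ε := by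
  unfold dOrd
  rcases (Set.Ioc b x).eq_empty_or_nonempty with he | hne
  · simp [he, hε]
  · rw [Set.Finite.csSup_lt_iff ((hT.finite_Ioc b x).image _) (hne.image _)]
    rintro _ ⟨u, hu, rfl⟩
    have hq0 : (0 : ℝ) < q := by linarith
    have hs := hT.finsum_Ioc_nonneg (q := q) hα b u
    have h2 : (2 : ℝ) ≤ 2 ^ q := by
      simpa using Real.rpow_le_rpow_of_exponent_le one_le_two hq.le
    have hσu := (hσ u).le
    refine (Real.rpow_lt_rpow_iff (z := q) (by positivity) (by positivity) hq0).1 ?_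
    rw [Real.mul_rpow (by positivity) hσu, ← Real.rpow_mul hs,
      one_div_mul_cancel hq0.ne', Real.rpow_one, Real.mul_rpow two_pos.le hε.le]
    exact (h u hu).trans_le (mul_le_mul_of_nonneg_right h2 (by positivity))

/-- A large covering number forces a large heavy family. -/
lemma exists_isHeavyFamily_of_lt_coveringNumber (hT : IsTree T) (hq : 1 < q)
    (hα : ∀ t, 0 < α t) (hσ : ∀ t, 0 < σ t) (hσmono : ∀ ⦃t s : T⦄, t ≤ s → σ s ≤ σ t)
    {glb : T → T → T} (hglb : IsGCA glb) {ε : ℝ} (hε : 0 < ε) (k : ℕ)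
    (hk : ((k ^ 2 : ℕ) : ℝ≥0∞) < coveringNumber (treeDist q α σ glb) (2 * ε)) :
    ∃ t v : Fin k → T, IsHeavyFamily (branchWeight q α σ) (ε ^ q) t v := by
  refine exists_isHeavyFamily hT hglb (Real.rpow_pos_of_pos hε q)
    (branchWeight_antitone_left hT hα hσ)
    (branchWeight_le_add hT (by linarith) hα hσ hσmono) branchWeight_eq_zero_of_not_lt k ?_
  intro B hB
  by_contra! hcon
  refine absurd (hk.trans_le (iInf₂_le B fun x => ?_)) (not_lt.2 (Nat.cast_le.2 hB))
  obtain ⟨b, hb, hbx, hlt⟩ := hcon x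
  refine ⟨b, hb, ?_⟩
  rw [treeDist, if_pos hbx]
  exact dOrd_lt_of_branchWeight_lt hT hq hα hσ hε hlt

end BranchWeight

lemma le_entropyNumber {X Y : Type} [NormedAddCommGroup X] [NormedSpace ℝ X]
    [NormedAddCommGroup Y] [NormedSpace ℝ Y] (n : ℕ) (V : X →L[ℝ] Y) (b : ℝ)
    (h : ∀ η > 0, ∀ F : Finset Y, F.card ≤ 2 ^ (n - 1) →
      (∀ x : X, ‖x‖ ≤ 1 → ∃ y ∈ F, ‖V x - y‖ < η) → b ≤ η) : b ≤ entropyNumber n V := by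
  refine le_csInf ⟨‖V‖ + 1, by positivity, {0}, by simpa using Nat.one_le_two_pow,
    fun x hx => ⟨0, by simp, ?_⟩⟩ ?_
  · rw [sub_zero]
    have := V.le_opNorm x
    nlinarith [norm_nonneg V]
  · rintro η ⟨hη, F, hF, hcov⟩
    exact h η hη F hF hcov

open Classical in
/-- The multiple of `σ(v)⁻¹ e_v - σ(t)⁻¹ e_t` whose image is supported by the interval `(t, v]`. -/
def intervalVector {T : Type} (σ : T → ℝ) (t v : T) : ellOne T :=
  (1 / 2 : ℝ) • lp.single 1 v (1 : ℝ) - (σ v / (2 * σ t)) • lp.single 1 t (1 : ℝ)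

lemma norm_intervalVector_le {T : Type} {σ : T → ℝ} (hσ : ∀ t, 0 < σ t) {t v : T} (h : σ v ≤ σ t) :
    ‖intervalVector σ t v‖ ≤ 1 := by
  classical
  have h1 : σ v / (2 * σ t) ≤ 1 / 2 := by
    rw [div_le_div_iff₀ (by linarith [hσ t]) two_pos]
    linarith
  have h0 : 0 ≤ σ v / (2 * σ t) := div_nonneg (hσ v).le (by linarith [hσ t])
  refine (norm_sub_le _ _).trans ?_
  rw [norm_smul, norm_smul, lp.norm_single one_pos, lp.norm_single one_pos, norm_one,
    Real.norm_of_nonneg h0, Real.norm_of_nonneg (by norm_num)]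
  linarith

section Operator

variable {T : Type} [PartialOrder T] {q : ℝ} {α σ : T → ℝ}
  [Fact (1 ≤ ENNReal.ofReal q)] {V : ellOne T →L[ℝ] ellQ T q}

open Classical in
lemma apply_single
    (hV : ∀ (x : ellOne T) (t : T), (V x : ∀ _ : T, ℝ) t =
      α t * ∑' s : {s : T // t ≤ s}, σ s.1 * (x : ∀ _ : T, ℝ) s.1) (s r : T) :
    (V (lp.single 1 s (1 : ℝ)) : ∀ _ : T, ℝ) r = if r ≤ s then α r * σ s else 0 := by
  rw [hV]
  split_ifs with h
  · rw [tsum_eq_single ⟨s, h⟩]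
    · simp
    · intro b hb
      have : b.1 ≠ s := fun e => hb (Subtype.ext e)
      simp [this]
  · have : ∀ b : {b : T // r ≤ b},
        σ b.1 * (lp.single (E := fun _ : T => ℝ) 1 s (1 : ℝ) : ∀ _ : T, ℝ) b.1 = 0 := by
      intro b
      have : b.1 ≠ s := fun e => h (e ▸ b.2)
      simp [this]
    rw [tsum_congr this, tsum_zero, mul_zero]

/-- The average of the interval vectors selected by the word `f`. -/
def wordVector {T : Type} (σ : T → ℝ) {k L : ℕ} (t v : Fin k × Fin L → T) (f : Fin k → Fin L) : ellOne T :=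
  (1 / (k : ℝ)) • ∑ i, intervalVector σ (t (i, f i)) (v (i, f i))

lemma norm_wordVector_le (hσ : ∀ t, 0 < σ t) (hσmono : ∀ ⦃t s : T⦄, t ≤ s → σ s ≤ σ t)
    {k L : ℕ} {t v : Fin k × Fin L → T} (htv : ∀ i, t i ≤ v i) (f : Fin k → Fin L) :
    ‖wordVector σ t v f‖ ≤ 1 := by
  rw [wordVector, norm_smul, Real.norm_of_nonneg (by positivity)]
  have : ‖∑ i, intervalVector σ (t (i, f i)) (v (i, f i))‖ ≤ k := by
    refine (norm_sum_le _ _).trans ((Finset.sum_le_sum fun i _ =>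
      norm_intervalVector_le hσ (hσmono (htv (i, f i)))).trans ?_)
    simp
  calc 1 / (k : ℝ) * _ ≤ 1 / (k : ℝ) * k := by gcongr
    _ ≤ 1 := by rw [one_div]; exact inv_mul_le_one

variable [OrderBot T]

open Classical in
lemma apply_intervalVector (hσ : ∀ t, 0 < σ t)
    (hV : ∀ (x : ellOne T) (t : T), (V x : ∀ _ : T, ℝ) t =
      α t * ∑' s : {s : T // t ≤ s}, σ s.1 * (x : ∀ _ : T, ℝ) s.1)
    (hT : IsTree T) {t v : T} (htv : t ≤ v) (r : T) :
    (V (intervalVector σ t v) : ∀ _ : T, ℝ) r =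
      if r ∈ Set.Ioc t v then α r * σ v / 2 else 0 := by
  have hne := (hσ t).ne'
  rw [intervalVector, map_sub, map_smul, map_smul, lp.coeFn_sub, lp.coeFn_smul, lp.coeFn_smul,
    Pi.sub_apply, Pi.smul_apply, Pi.smul_apply, apply_single hV, apply_single hV]
  by_cases hrv : r ≤ v
  · by_cases hrt : r ≤ t
    · have : r ∉ Set.Ioc t v := fun h => absurd (h.1.trans_le hrt) (lt_irrefl _)
      rw [if_pos hrv, if_pos hrt, if_neg this]
      simp only [smul_eq_mul]
      field_simp
      ring
    · have : r ∈ Set.Ioc t v :=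
        ⟨lt_of_le_not_ge ((hT.2.1 v r t hrv htv).resolve_left hrt) hrt, hrv⟩
      rw [if_pos hrv, if_neg hrt, if_pos this]
      simp only [smul_eq_mul]
      ring
  · have hrt : ¬ r ≤ t := fun h => hrv (h.trans htv)
    have : r ∉ Set.Ioc t v := fun h => hrv h.2
    rw [if_neg hrv, if_neg hrt, if_neg this]
    simp

/-- Images of word vectors of words differing in many places are far apart. -/
lemma le_norm_apply_wordVector_sub (hq : 1 < q) (hα : ∀ t, 0 < α t) (hσ : ∀ t, 0 < σ t)
    (hV : ∀ (x : ellOne T) (t : T), (V x : ∀ _ : T, ℝ) t =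
      α t * ∑' s : {s : T // t ≤ s}, σ s.1 * (x : ∀ _ : T, ℝ) s.1)
    (hT : IsTree T) {k L : ℕ} {t v : Fin k × Fin L → T} (htv : ∀ i, t i ≤ v i)
    {ε : ℝ} (hε : 0 < ε) (h : IsHeavyFamily (branchWeight q α σ) (ε ^ q) t v)
    (f g : Fin k → Fin L) :
    (Finset.univ.filter fun i => f i ≠ g i).card * (ε / (2 * k)) ^ q ≤
      ‖V (wordVector σ t v f) - V (wordVector σ t v g)‖ ^ q := by
  classical
  have hq0 : 0 < q := by linarith
  have hqr : (ENNReal.ofReal q).toReal = q := ENNReal.toReal_ofReal hq0.le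
  have hval : ∀ f : Fin k → Fin L, ∀ r, (V (wordVector σ t v f) : ∀ _ : T, ℝ) r =
      (1 / (k : ℝ)) * ∑ i, if r ∈ Set.Ioc (t (i, f i)) (v (i, f i))
        then α r * σ (v (i, f i)) / 2 else 0 := by
    intro f r
    rw [wordVector, map_smul, map_sum, lp.coeFn_smul, Pi.smul_apply, lp.coeFn_sum,
      Finset.sum_apply, smul_eq_mul]
    simp only [apply_intervalVector hσ hV hT (htv _)]
  set D := Finset.univ.filter fun i => f i ≠ g i
  let I : Fin k → Finset T := fun i => (hT.finite_Ioc (t (i, f i)) (v (i, f i))).toFinset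
  have hI : ∀ i r, r ∈ I i ↔ r ∈ Set.Ioc (t (i, f i)) (v (i, f i)) := fun i r => by simp [I]
  have hpt : ∀ i ∈ D, ∀ r ∈ I i,
      ((V (wordVector σ t v f) - V (wordVector σ t v g) : ellQ T q) : ∀ _ : T, ℝ) r =
        (1 / (k : ℝ)) * (α r * σ (v (i, f i)) / 2) := by
    intro i hi r hr
    rw [hI] at hr
    rw [lp.coeFn_sub, Pi.sub_apply, hval, hval, Finset.sum_eq_single i, if_pos hr,
      Finset.sum_eq_zero, mul_zero, sub_zero]
    · intro j _
      rw [if_neg]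
      intro hj
      refine Set.disjoint_left.1 (h.disjoint (i := (i, f i)) (j := (j, g j)) ?_) hr hj
      intro e
      obtain ⟨rfl, e2⟩ := Prod.mk.inj e
      exact (Finset.mem_filter.1 hi).2 e2
    · intro j _ hji
      rw [if_neg]
      intro hj
      exact Set.disjoint_left.1 (h.disjoint (i := (i, f i)) (j := (j, f j))
        fun e => hji (Prod.mk.inj e).1.symm) hr hj
    · intro hi
      exact absurd (Finset.mem_univ i) hi
  have hdisj : (D : Set (Fin k)).PairwiseDisjoint I := by
    intro i _ j _ hij
    refine Finset.disjoint_left.2 fun r hr hr' => ?_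
    rw [hI] at hr hr'
    exact Set.disjoint_left.1 (h.disjoint (i := (i, f i)) (j := (j, f j))
        fun e => hij (Prod.mk.inj e).1) hr hr'
  have hnorm := lp.sum_rpow_le_norm_rpow (by rw [hqr]; exact hq0)
    (V (wordVector σ t v f) - V (wordVector σ t v g)) (D.biUnion I)
  rw [hqr, Finset.sum_biUnion hdisj] at hnorm
  refine le_trans ?_ hnorm
  rw [← nsmul_eq_mul]
  refine Finset.card_nsmul_le_sum _ _ _ fun i hi => ?_
  have hw := h.le_weight (i, f i)
  rw [branchWeight, finsum_mem_eq_finite_toFinset_sum _ (hT.finite_Ioc _ _)] at hw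
  have hk0 : (0 : ℝ) ≤ 1 / (2 * k) := by positivity
  calc (ε / (2 * k)) ^ q = (1 / (2 * k)) ^ q * ε ^ q := by
        rw [← Real.mul_rpow hk0 hε.le]; congr 1; ring
    _ ≤ (1 / (2 * k)) ^ q * ((∑ r ∈ I i, α r ^ q) * σ (v (i, f i)) ^ q) := by
        gcongr
    _ = ∑ r ∈ I i, ‖((V (wordVector σ t v f) - V (wordVector σ t v g) : ellQ T q) :
          ∀ _ : T, ℝ) r‖ ^ q := by
        rw [Finset.sum_mul, Finset.mul_sum]
        refine Finset.sum_congr rfl fun r hr => ?_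
        have h1 := (hα r).le
        have h2 := (hσ (v (i, f i))).le
        rw [hpt i hi r hr, Real.norm_of_nonneg (by positivity), ← Real.mul_rpow h1 h2,
          ← Real.mul_rpow hk0 (by positivity)]
        congr 1
        ring

/-- Lower bound for the entropy numbers in terms of covering numbers of the tree. -/
lemma le_entropyNumber_of_lt_coveringNumber (hT : IsTree T) (hq : 1 < q)
    (hα : ∀ t, 0 < α t) (hσ : ∀ t, 0 < σ t) (hσmono : ∀ ⦃t s : T⦄, t ≤ s → σ s ≤ σ t)
    {glb : T → T → T} (hglb : IsGCA glb)
    (hV : ∀ (x : ellOne T) (t : T), (V x : ∀ _ : T, ℝ) t =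
      α t * ∑' s : {s : T // t ≤ s}, σ s.1 * (x : ∀ _ : T, ℝ) s.1)
    {ε : ℝ} (hε : 0 < ε) {k R n : ℕ} (hk : 0 < k) (hR : 2 ^ (n - 1) < R ^ k)
    (hN : (((8 * k * R) ^ 2 : ℕ) : ℝ≥0∞) < coveringNumber (treeDist q α σ glb) (2 * ε)) :
    ε / 8 * (k : ℝ) ^ (-(1 - 1 / q)) ≤ entropyNumber n V := by
  classical
  have hq0 : 0 < q := by linarith
  obtain ⟨t₀, v₀, h₀⟩ :=
    exists_isHeavyFamily_of_lt_coveringNumber hT hq hα hσ hσmono hglb hε _ hN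
  let e : Fin (2 * k) × Fin (4 * R) ≃ Fin (8 * k * R) :=
    finProdFinEquiv.trans (finCongr (by ring))
  have h : IsHeavyFamily (branchWeight q α σ) (ε ^ q) (t₀ ∘ e) (v₀ ∘ e) :=
    ⟨fun i => h₀.le_weight _, fun i => h₀.weight_lt _,
      fun i j hij => h₀.disjoint (e.injective.ne hij)⟩
  have htv : ∀ i, (t₀ ∘ e) i ≤ (v₀ ∘ e) i := by
    intro i
    by_contra hcon
    have h1 := h.le_weight i
    rw [branchWeight_eq_zero_of_not_lt fun hlt => hcon hlt.le] at h1
    exact absurd (Real.rpow_pos_of_pos hε q) (not_lt.2 h1)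
  refine le_entropyNumber n V _ fun η hη F hF hcov => ?_
  choose φ hφF hφ using fun f =>
    hcov (wordVector σ (t₀ ∘ e) (v₀ ∘ e) f) (norm_wordVector_le hσ hσmono htv f)
  obtain ⟨f, g, hfg, hd⟩ := exists_same_color_of_card_lt k R F (hF.trans_lt hR) φ hφF
  have hnorm : ‖V (wordVector σ (t₀ ∘ e) (v₀ ∘ e) f) -
      V (wordVector σ (t₀ ∘ e) (v₀ ∘ e) g)‖ ≤ 2 * η := by
    have h1 := hφ f
    have h2 := hφ g
    rw [hfg] at h1
    have h3 := norm_sub_le_norm_sub_add_norm_sub (V (wordVector σ (t₀ ∘ e) (v₀ ∘ e) f)) (φ g)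
      (V (wordVector σ (t₀ ∘ e) (v₀ ∘ e) g))
    rw [norm_sub_rev (φ g)] at h3
    linarith
  have hsep := le_norm_apply_wordVector_sub hq hα hσ hV hT htv hε h f g
  have hkR : (0 : ℝ) < k := by exact_mod_cast hk
  have hkey : (ε / 4 * (k : ℝ) ^ (-(1 - 1 / q))) ^ q ≤ (2 * η) ^ q := by
    calc (ε / 4 * (k : ℝ) ^ (-(1 - 1 / q))) ^ q
        = (k : ℝ) * (ε / (2 * (2 * k : ℕ))) ^ q := by
          have : (-(1 - 1 / q)) = 1 / q - 1 := by ring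
          rw [this, Real.rpow_sub hkR, Real.rpow_one,
            show ε / 4 * ((k : ℝ) ^ (1 / q) / k) = (k : ℝ) ^ (1 / q) * (ε / (2 * (2 * k : ℕ))) by
              push_cast; field_simp; ring,
            Real.mul_rpow (by positivity) (by positivity), ← Real.rpow_mul hkR.le,
            one_div_mul_cancel hq0.ne', Real.rpow_one]
      _ ≤ (Finset.univ.filter fun i => f i ≠ g i).card * (ε / (2 * (2 * k : ℕ))) ^ q := by
          gcongr
      _ ≤ _ := hsep
      _ ≤ (2 * η) ^ q := by gcongr
  have := (Real.rpow_le_rpow_iff (by positivity) (by positivity) hq0).1 hkey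
  linarith

end Operator

/-- For `L` bounded below, the radius `δ * L ^ (-1 / a)` is small and `c` times its power
`-a` dominates `15 * L`. -/
lemma exists_scale {a c ε₀ : ℝ} (ha : 0 < a) (hc : 0 < c) (hε₀ : 0 < ε₀) :
    ∃ δ > 0, ∀ L ≥ Real.log 2, 2 * (δ * L ^ (-(1 / a))) < ε₀ ∧
      15 * L ≤ c * (2 * (δ * L ^ (-(1 / a)))) ^ (-a) := by
  have hlog : 0 < Real.log 2 := Real.log_pos one_lt_two
  set δ₁ : ℝ := (15 / c) ^ (-(1 / a)) / 2
  set δ₂ : ℝ := ε₀ / (4 * Real.log 2 ^ (-(1 / a)))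
  have hδ₁ : 0 < δ₁ := by positivity
  have hδ₂ : 0 < δ₂ := by positivity
  have hδ : 0 < min δ₁ δ₂ := lt_min hδ₁ hδ₂
  refine ⟨min δ₁ δ₂, hδ, fun L hL => ?_⟩
  have hL0 : 0 < L := hlog.trans_le hL
  have hpow : L ^ (-(1 / a)) ≤ Real.log 2 ^ (-(1 / a)) :=
    Real.rpow_le_rpow_of_nonpos hlog hL (by simp [ha.le])
  constructor
  · calc 2 * (min δ₁ δ₂ * L ^ (-(1 / a))) ≤ 2 * (δ₂ * Real.log 2 ^ (-(1 / a))) := by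
          gcongr; exact min_le_right _ _
      _ = ε₀ / 2 := by simp only [δ₂]; field_simp; ring
      _ < ε₀ := half_lt_self hε₀
  · have h1 : 15 / c ≤ (2 * min δ₁ δ₂) ^ (-a) := by
      calc 15 / c = (2 * δ₁) ^ (-a) := by
            simp only [δ₁]
            rw [mul_div_cancel₀ _ two_ne_zero, ← Real.rpow_mul (by positivity)]
            rw [neg_mul_neg, one_div_mul_cancel ha.ne', Real.rpow_one]
        _ ≤ _ := Real.rpow_le_rpow_of_nonpos (by positivity)
            (by gcongr; exact min_le_left _ _) (by linarith)
    rw [← mul_assoc, Real.mul_rpow (by positivity) (by positivity), ← Real.rpow_mul hL0.le,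
      neg_mul_neg, one_div_mul_cancel ha.ne', Real.rpow_one]
    calc 15 * L = c * (15 / c * L) := by field_simp
      _ ≤ _ := by gcongr

theorem stmt10 {T : Type} [Countable T] [PartialOrder T] [OrderBot T]
    (htree : IsTree T) (q : ℝ) (hq : 1 < q)
    (α σ : T → ℝ) (hα : ∀ t, 0 < α t) (hσpos : ∀ t, 0 < σ t)
    (hσmono : ∀ ⦃t s : T⦄, t ≤ s → σ s ≤ σ t)
    (K : ℝ) (hK : ∀ s : T, (∑ᶠ r ∈ Set.Iic s, α r ^ q) ^ (1 / q) * σ s ≤ K)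
    (glb : T → T → T) (hglb : IsGCA glb)
    [Fact (1 ≤ ENNReal.ofReal q)]
    (V : ellOne T →L[ℝ] ellQ T q)
    (hV : ∀ (x : ellOne T) (t : T), (V x : ∀ _ : T, ℝ) t =
      α t * ∑' s : {s : T // t ≤ s}, σ s.1 * (x : ∀ _ : T, ℝ) s.1)
    (q' : ℝ) (hq' : 1 / q' = 1 - 1 / q)
    (a c : ℝ) (ha : 0 < a) (hc : 0 < c)
    (hN : ∃ ε₀ > 0, ∀ ε : ℝ, 0 < ε → ε < ε₀ →
      ENNReal.ofReal (Real.exp (c * ε ^ (-a))) ≤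
        coveringNumber (treeDist q α σ glb) ε) :
    ∃ c' > 0, ∀ n : ℕ, 2 ≤ n →
      (a < q' → c' * (n : ℝ) ^ (-(1 / q')) * Real.log n ^ (1 / q' - 1 / a) ≤
        entropyNumber n V) ∧
      (q' ≤ a → c' * (n : ℝ) ^ (-(1 / a)) ≤ entropyNumber n V) := by
  obtain ⟨ε₀, hε₀, hcov⟩ := hN
  obtain ⟨δ, hδ, hscale⟩ := exists_scale ha hc hε₀
  have hlog2 : 1 / 2 < Real.log 2 := by linarith [Real.log_two_gt_d9]
  have hbound : ∀ (L : ℝ) (k R n : ℕ), Real.log 2 ≤ L → 0 < k → 2 ^ (n - 1) < R ^ k →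
      ((8 * k * R : ℕ) : ℝ) ^ 2 < Real.exp (15 * L) →
      δ * L ^ (-(1 / a)) / 8 * (k : ℝ) ^ (-(1 / q')) ≤ entropyNumber n V := by
    intro L k R n hL hk hR hlt
    obtain ⟨h1, h2⟩ := hscale L hL
    have hL0 : 0 < L := by linarith
    rw [hq']
    refine le_entropyNumber_of_lt_coveringNumber htree hq hα hσpos hσmono hglb hV
      (by positivity) hk hR (lt_of_lt_of_le ?_ (hcov _ (by positivity) h1))
    rw [← ENNReal.ofReal_natCast]
    refine (ENNReal.ofReal_lt_ofReal_iff (Real.exp_pos _)).2 ?_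
    push_cast at hlt ⊢
    exact hlt.trans_le (Real.exp_le_exp.2 h2)
  have hq'0 : 0 ≤ 1 / q' := by
    rw [hq', sub_nonneg, div_le_one (by linarith)]
    exact hq.le
  refine ⟨δ / 8 * 4 ^ (-(1 / q')), by positivity, fun n hn => ⟨fun _ => ?_, fun _ => ?_⟩⟩
  · have hn2 : (2 : ℝ) ≤ n := by exact_mod_cast hn
    have hn0 : (0 : ℝ) < n := by linarith
    have hL : Real.log 2 ≤ Real.log n := Real.log_le_log two_pos hn2
    have hL0 : 0 < Real.log n := by linarith
    have hLn : Real.log n ≤ n := (Real.log_le_sub_one_of_pos hn0).trans (by linarith)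
    set k := ⌈(n : ℝ) / Real.log n⌉₊
    have hk1 : (n : ℝ) / Real.log n ≤ k := Nat.le_ceil _
    have hk0 : 0 < k := Nat.ceil_pos.2 (by positivity)
    have hk0' : (0 : ℝ) < k := by exact_mod_cast hk0
    have hk2 : (k : ℝ) ≤ 2 * n / Real.log n := by
      have h1 := (Nat.ceil_lt_add_one (show 0 ≤ (n : ℝ) / Real.log n by positivity)).le
      have h2 : 1 ≤ (n : ℝ) / Real.log n := (one_le_div hL0).2 hLn
      rw [mul_div_assoc]
      linarith
    have hk4 : (k : ℝ) ≤ 4 * n := by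
      refine hk2.trans ((div_le_iff₀ hL0).2 ?_)
      nlinarith
    have hR : 2 ^ (n - 1) < n ^ k := by
      have h1 : (2 : ℝ) ^ n < (n : ℝ) ^ k := by
        calc (2 : ℝ) ^ n < Real.exp 1 ^ n := by
              gcongr
              linarith [Real.exp_one_gt_d9]
          _ = Real.exp n := by rw [← Real.exp_nat_mul, mul_one]
          _ ≤ Real.exp (k * Real.log n) := Real.exp_le_exp.2 ((div_le_iff₀ hL0).1 hk1)
          _ = (n : ℝ) ^ k := by rw [Real.exp_nat_mul, Real.exp_log hn0]
      exact (Nat.pow_le_pow_right two_pos (Nat.sub_le n 1)).trans_lt (by exact_mod_cast h1)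
    have hlt : ((8 * k * n : ℕ) : ℝ) ^ 2 < Real.exp (15 * Real.log n) := by
      have h1 : Real.exp (15 * Real.log n) = (n : ℝ) ^ 15 := by
        have := Real.exp_nat_mul (Real.log n) 15
        rw [Real.exp_log hn0] at this
        exact_mod_cast this
      rw [h1]
      push_cast
      calc (8 * (k : ℝ) * n) ^ 2 ≤ (8 * (4 * n) * n) ^ 2 := by gcongr
        _ = 2 ^ 10 * (n : ℝ) ^ 4 := by ring
        _ ≤ (n : ℝ) ^ 10 * (n : ℝ) ^ 4 := by gcongr
        _ = (n : ℝ) ^ 14 := by ring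
        _ < (n : ℝ) ^ 15 := pow_lt_pow_right₀ (by linarith) (by norm_num)
    refine le_trans ?_ (hbound (Real.log n) k n n hL hk0 hR hlt)
    have hkpow : (4 * (n : ℝ) / Real.log n) ^ (-(1 / q')) ≤ (k : ℝ) ^ (-(1 / q')) := by
      refine Real.rpow_le_rpow_of_nonpos hk0' (hk2.trans ?_) (by linarith)
      gcongr
      norm_num
    have hsplit : (4 * (n : ℝ) / Real.log n) ^ (-(1 / q')) =
        4 ^ (-(1 / q')) * (n : ℝ) ^ (-(1 / q')) * Real.log n ^ (1 / q') := by
      rw [Real.div_rpow (by positivity) hL0.le, Real.mul_rpow (by norm_num) hn0.le,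
        Real.rpow_neg hL0.le, div_inv_eq_mul]
    calc δ / 8 * 4 ^ (-(1 / q')) * (n : ℝ) ^ (-(1 / q')) * Real.log n ^ (1 / q' - 1 / a)
        = δ * Real.log n ^ (-(1 / a)) / 8 * (4 * (n : ℝ) / Real.log n) ^ (-(1 / q')) := by
          rw [hsplit, sub_eq_add_neg, Real.rpow_add hL0]
          ring
      _ ≤ _ := by gcongr
  · have hn2 : (2 : ℝ) ≤ n := by exact_mod_cast hn
    have hlt : ((8 * 1 * 2 ^ n : ℕ) : ℝ) ^ 2 < Real.exp (15 * n) := by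
      calc ((8 * 1 * 2 ^ n : ℕ) : ℝ) ^ 2 = 2 ^ (2 * n + 6) := by push_cast; ring
        _ < Real.exp 1 ^ (2 * n + 6) := by
            gcongr
            linarith [Real.exp_one_gt_d9]
        _ = Real.exp (2 * n + 6) := by rw [← Real.exp_nat_mul, mul_one]; push_cast; rfl
        _ ≤ Real.exp (15 * n) := Real.exp_le_exp.2 (by linarith)
    have h := hbound n 1 (2 ^ n) n (by linarith [Real.log_two_lt_d9]) one_pos
      (by rw [pow_one]; exact Nat.pow_lt_pow_right one_lt_two (by omega)) hlt
    refine le_trans ?_ h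
    rw [Nat.cast_one, Real.one_rpow, mul_one]
    have h4 : (4 : ℝ) ^ (-(1 / q')) ≤ 1 :=
      Real.rpow_le_one_of_one_le_of_nonpos (by norm_num) (by linarith)
    calc δ / 8 * 4 ^ (-(1 / q')) * (n : ℝ) ^ (-(1 / a))
        ≤ δ / 8 * 1 * (n : ℝ) ^ (-(1 / a)) := by gcongr
      _ = δ * (n : ℝ) ^ (-(1 / a)) / 8 := by ring
end
end

section
/- Suppose R(n) ≤ c n^H for some H ≥ 0 and c > 0, and α(t)σ(t) ≤ c |t|^{-γ/q} for all t ∈ T with |t| ≥ 1, for some γ > 1. Then there exists a constant C > 0 such that for all sufficiently small ε > 0: Ñ(T,d,ε) ≤ C ε^{-qH/(γ−1)} if γ < H+1; Ñ(T,d,ε) ≤ C ε^{-q} log(1/ε) if γ = H+1; and Ñ(T,d,ε) ≤ C ε^{-q(H+1)/γ} if γ > H+1. -/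
open scoped ENNReal NNReal
open MeasureTheory

noncomputable section

section Generation

variable {T : Type} [PartialOrder T] [OrderBot T]

lemma IsTree.finite_Iio (h : IsTree T) (t : T) : (Set.Iio t).Finite :=
  (h.1 t).subset Set.Iio_subset_Iic_self

lemma IsTree.gen_strictMono (h : IsTree T) : StrictMono (gen : T → ℕ) := by
  intro s t hst
  simp only [gen, Nat.card_coe_set_eq]
  refine Set.ncard_lt_ncard ⟨Set.Iio_subset_Iio hst.le, fun hsub => ?_⟩ (h.finite_Iio t)
  exact lt_irrefl s (hsub hst)

lemma IsTree.eq_bot_of_gen_eq_zero (h : IsTree T) {t : T} (ht : gen t = 0) : t = ⊥ := by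
  by_contra hne
  have := h.gen_strictMono (bot_lt_iff_ne_bot.2 hne)
  omega

lemma IsTree.gen_injOn_Iic (h : IsTree T) (t : T) : Set.InjOn gen (Set.Iic t) := by
  intro a ha b hb hab
  rcases h.2.1 t a b ha hb with hle | hle
  · exact hle.eq_of_not_lt fun hlt => (h.gen_strictMono hlt).ne hab
  · exact (hle.eq_of_not_lt fun hlt => (h.gen_strictMono hlt).ne' hab).symm

lemma IsTree.image_gen_Iic (h : IsTree T) (t : T) : gen '' Set.Iic t = Set.Iic (gen t) := by
  refine Set.eq_of_subset_of_ncard_le ?_ ?_ (Set.finite_Iic _)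
  · rintro _ ⟨s, hs, rfl⟩
    exact h.gen_strictMono.monotone hs
  · rw [(h.gen_injOn_Iic t).ncard_image, ← Set.Iio_insert (a := t),
      Set.ncard_insert_of_notMem (by simp) (h.finite_Iio t), ← Nat.card_coe_set_eq (Set.Iio t)]
    simp [gen]

lemma IsTree.exists_le_gen_eq (h : IsTree T) {t : T} {n : ℕ} (hn : n ≤ gen t) :
    ∃ s ≤ t, gen s = n := by
  have : n ∈ gen '' Set.Iic t := by rw [h.image_gen_Iic]; exact hn
  exact this

lemma IsTree.finite_gen_eq (h : IsTree T) (n : ℕ) : {t : T | gen t = n}.Finite := by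
  induction n with
  | zero =>
    exact (Set.finite_singleton (⊥ : T)).subset fun t ht => h.eq_bot_of_gen_eq_zero ht
  | succ n ih =>
    refine (ih.biUnion fun u _ => h.2.2 u).subset fun t (ht : gen t = n + 1) => ?_
    obtain ⟨u, hut, hu⟩ := h.exists_le_gen_eq (t := t) (n := n) (by omega)
    simp only [Set.mem_iUnion]
    refine ⟨u, hu, hut.lt_of_ne (by rintro rfl; omega), fun v huv hvt => ?_⟩
    have := h.gen_strictMono huv
    have := h.gen_strictMono hvt
    omega

lemma IsTree.card_gen_eq_zero_le (h : IsTree T) : Nat.card {t : T | gen t = 0} ≤ 1 := by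
  rw [Nat.card_coe_set_eq, Set.ncard_le_one (h.finite_gen_eq 0)]
  intro a ha b hb
  rw [h.eq_bot_of_gen_eq_zero ha, h.eq_bot_of_gen_eq_zero hb]

/-- A sum along a branch of a function of the generation is a sum over generations. -/
lemma IsTree.sum_Ioc_gen_le (h : IsTree T) {f : ℕ → ℝ} (hf : ∀ n, 0 ≤ f n) (s v : T)
    {m : ℕ} (hm : gen v ≤ m) :
    ∑ r ∈ ((h.1 v).subset (Set.Ioc_subset_Iic_self (a := s))).toFinset, f (gen r) ≤
      ∑ n ∈ Finset.Ioc (gen s) m, f n := by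
  classical
  rw [← Finset.sum_image (f := f) (g := gen)]
  · refine Finset.sum_le_sum_of_subset_of_nonneg ?_ fun _ _ _ => hf _
    intro n hn
    simp only [Finset.mem_image, Set.Finite.mem_toFinset, Set.mem_Ioc] at hn
    obtain ⟨r, ⟨hsr, hrv⟩, rfl⟩ := hn
    exact Finset.mem_Ioc.2 ⟨h.gen_strictMono hsr, (h.gen_strictMono.monotone hrv).trans hm⟩
  · intro a ha b hb hab
    simp only [Set.Finite.coe_toFinset, Set.mem_Ioc] at ha hb
    exact h.gen_injOn_Iic v ha.2 hb.2 hab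

/-- The branch distance is controlled by the sum of the weight bounds over generations. -/
lemma IsTree.dOrd_le (h : IsTree T) {q : ℝ} (hq : 0 < q) {α σ : T → ℝ} (hα : ∀ t, 0 < α t)
    (hσpos : ∀ t, 0 < σ t) (hσmono : Antitone σ) {w : ℕ → ℝ} (hw0 : ∀ n, 0 ≤ w n)
    (hw : ∀ t, 1 ≤ gen t → (α t * σ t) ^ q ≤ w (gen t)) (s t : T) :
    dOrd q α σ s t ≤ (∑ n ∈ Finset.Ioc (gen s) (gen t), w n) ^ (1 / q) := by
  have hsum0 : 0 ≤ ∑ n ∈ Finset.Ioc (gen s) (gen t), w n := Finset.sum_nonneg fun n _ => hw0 n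
  refine Real.sSup_le ?_ (Real.rpow_nonneg hsum0 _)
  rintro _ ⟨v, ⟨-, hvt⟩, rfl⟩
  have hfin := (h.1 v).subset (Set.Ioc_subset_Iic_self (a := s))
  have hα0 : 0 ≤ ∑ r ∈ hfin.toFinset, α r ^ q :=
    Finset.sum_nonneg fun r _ => Real.rpow_nonneg (hα r).le _
  have hσq : σ v = (σ v ^ q) ^ (1 / q) := by
    rw [← Real.rpow_mul (hσpos v).le, mul_one_div_cancel hq.ne', Real.rpow_one]
  simp only
  rw [finsum_mem_eq_finite_toFinset_sum _ hfin, hσq,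
    ← Real.mul_rpow hα0 (Real.rpow_nonneg (hσpos v).le _)]
  refine Real.rpow_le_rpow (mul_nonneg hα0 (Real.rpow_nonneg (hσpos v).le _)) ?_ (by positivity)
  refine le_trans ?_ (h.sum_Ioc_gen_le hw0 s v (h.gen_strictMono.monotone hvt))
  rw [Finset.sum_mul]
  refine Finset.sum_le_sum fun r hr => ?_
  obtain ⟨hsr, hrv⟩ := hfin.mem_toFinset.1 hr
  refine le_trans ?_ (hw r (Nat.one_le_of_lt (h.gen_strictMono hsr)))
  rw [← Real.mul_rpow (hα r).le (hσpos v).le]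
  exact Real.rpow_le_rpow (mul_pos (hα r) (hσpos v)).le
    (mul_le_mul_of_nonneg_left (hσmono hrv) (hα r).le) hq.le

/-- A finite set of generations such that every branch segment starting at the last
selected generation is short yields an order net. -/
lemma IsTree.orderCoveringNumber_le (h : IsTree T) {d : T → T → ℝ} {ε : ℝ} (A : Finset ℕ)
    (hA : ∀ t : T, ∃ n ∈ A, n ≤ gen t ∧ ∀ s ≤ t, gen s = n → d s t < ε) :
    orderCoveringNumber d ε ≤
      ENNReal.ofReal (∑ n ∈ A, (Nat.card {t : T | gen t = n} : ℝ)) := by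
  classical
  set S : Finset T := A.biUnion fun n => (h.finite_gen_eq n).toFinset with hS
  refine (iInf₂_le S ?_).trans ?_
  · intro t
    obtain ⟨n, hn, hnt, hd⟩ := hA t
    obtain ⟨s, hst, hs⟩ := h.exists_le_gen_eq hnt
    exact ⟨s, by simpa [hS, hs] using hn, hst, hd s hst hs⟩
  · rw [← Nat.cast_sum, ENNReal.ofReal_natCast]
    norm_cast
    refine Finset.card_biUnion_le.trans (Finset.sum_le_sum fun n _ => ?_)
    rw [Nat.card_coe_set_eq, Set.ncard_eq_toFinset_card _ (h.finite_gen_eq n)]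

end Generation

section Sums

lemma Real.mul_rpow_neg_le_sub {γ : ℝ} (hγ : 1 < γ) {m : ℕ} (hm : 1 ≤ m) :
    (γ - 1) * ((m + 1 : ℕ) : ℝ) ^ (-γ) ≤ (m : ℝ) ^ (1 - γ) - ((m + 1 : ℕ) : ℝ) ^ (1 - γ) := by
  have hm0 : (0 : ℝ) < m := by exact_mod_cast hm
  push_cast
  set y : ℝ := (m : ℝ) + 1 with hy
  have hy0 : 0 < y := by positivity
  set x : ℝ := m / y with hx
  have hx0 : 0 < x := by positivity
  have hmx : (m : ℝ) = x * y := by rw [hx]; field_simp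
  have hB : 1 + (γ - 1) * (1 / y) ≤ x ^ (1 - γ) := by
    rw [Real.rpow_def_of_pos hx0]
    have h1 := Real.add_one_le_exp (Real.log x * (1 - γ))
    have h2 := Real.log_le_sub_one_of_pos hx0
    have h3 : x - 1 = -(1 / y) := by rw [hx]; field_simp; rw [hy]; ring
    nlinarith
  have hsplit : y ^ (-γ) = y ^ (1 - γ) * (1 / y) := by
    rw [show -γ = (1 - γ) - 1 by ring, Real.rpow_sub_one hy0.ne']; ring
  rw [hsplit, hmx, Real.mul_rpow hx0.le hy0.le]
  have hp : 0 < y ^ (1 - γ) := Real.rpow_pos_of_pos hy0 _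
  nlinarith

lemma Real.sum_Ioc_rpow_neg_le {γ : ℝ} (hγ : 1 < γ) {m n : ℕ} (hm : 1 ≤ m) (hmn : m ≤ n) :
    ∑ k ∈ Finset.Ioc m n, (k : ℝ) ^ (-γ) ≤
      ((m : ℝ) ^ (1 - γ) - (n : ℝ) ^ (1 - γ)) / (γ - 1) := by
  rw [le_div_iff₀ (by linarith)]
  induction n, hmn using Nat.le_induction with
  | base => simp
  | succ n hmn ih =>
    rw [Finset.sum_Ioc_succ_top hmn]
    have := Real.mul_rpow_neg_le_sub hγ (hm.trans hmn)
    linarith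

lemma Real.sum_Icc_rpow_neg_le_of_lt_one {p : ℝ} (hp0 : 0 ≤ p) (hp1 : p < 1) (n : ℕ) :
    ∑ k ∈ Finset.Icc 1 n, (k : ℝ) ^ (-p) ≤ (n : ℝ) ^ (1 - p) / (1 - p) := by
  rw [le_div_iff₀ (by linarith)]
  induction n with
  | zero => simp [Real.zero_rpow (show 1 - p ≠ 0 by linarith)]
  | succ n ih =>
    rw [Finset.sum_Icc_succ_top (by omega)]
    push_cast
    set y : ℝ := (n : ℝ) + 1 with hy
    have hy0 : 0 < y := by positivity
    have hn : (n : ℝ) = (1 + -(1 / y)) * y := by field_simp; rw [hy]; ring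
    have hy1 : 1 / y ≤ 1 := by
      rw [div_le_one hy0, hy]; linarith [(Nat.cast_nonneg n : (0 : ℝ) ≤ n)]
    have hB := rpow_one_add_le_one_add_mul_self (s := -(1 / y)) (p := 1 - p)
      (by linarith) (by linarith) (by linarith)
    have hsplit : y ^ (-p) = y ^ (1 - p) * (1 / y) := by
      rw [show -p = (1 - p) - 1 by ring, Real.rpow_sub_one hy0.ne']; ring
    have hp : 0 < y ^ (1 - p) := Real.rpow_pos_of_pos hy0 _
    have hstep : (n : ℝ) ^ (1 - p) ≤ (1 + (1 - p) * -(1 / y)) * y ^ (1 - p) := by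
      conv_lhs => rw [hn]
      rw [Real.mul_rpow (by linarith) hy0.le]
      exact mul_le_mul_of_nonneg_right hB hp.le
    rw [hsplit]
    nlinarith

lemma Real.exists_sum_Icc_rpow_neg_le {p : ℝ} (hp : 1 < p) :
    ∃ B > 0, ∀ n : ℕ, ∑ k ∈ Finset.Icc 1 n, (k : ℝ) ^ (-p) ≤ B := by
  have hs : Summable fun n : ℕ => (n : ℝ) ^ (-p) := Real.summable_nat_rpow.2 (by linarith)
  refine ⟨∑' n : ℕ, (n : ℝ) ^ (-p) + 1, ?_, fun n => ?_⟩
  · have : 0 ≤ ∑' n : ℕ, (n : ℝ) ^ (-p) := tsum_nonneg fun n => by positivity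
    linarith
  · have := hs.sum_le_tsum (Finset.Icc 1 n) fun k _ => Real.rpow_nonneg (Nat.cast_nonneg k) _
    linarith

lemma Real.sum_Icc_rpow_neg_one_le (n : ℕ) :
    ∑ k ∈ Finset.Icc 1 n, (k : ℝ) ^ (-(1 : ℝ)) ≤ 1 + Real.log n := by
  have := harmonic_le_one_add_log n
  rw [harmonic_eq_sum_Icc] at this
  push_cast at this
  simpa only [Real.rpow_neg_one] using this

end Sums

section Levels

/-- The real threshold whose `(1 - γ)`-th power is `j * N ^ (-γ)`. -/
def levelThreshold (γ : ℝ) (N j : ℕ) : ℝ := ((N : ℝ) ^ γ / j) ^ (1 / (γ - 1))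

open Classical in
/-- The generations selected for the net: all up to `N`, then the rounded thresholds. -/
def selectedLevels (γ : ℝ) (N : ℕ) : Finset ℕ :=
  Finset.range (N + 1) ∪ (Finset.Icc 1 N).image fun j => ⌈levelThreshold γ N j⌉₊

variable {γ : ℝ} {N j : ℕ}

lemma levelThreshold_rpow (hγ : 1 < γ) (hN : 1 ≤ N) (hj : 1 ≤ j) :
    levelThreshold γ N j ^ (1 - γ) = j * (N : ℝ) ^ (-γ) := by
  have hN0 : (0 : ℝ) < N := by exact_mod_cast hN
  have hj0 : (0 : ℝ) < j := by exact_mod_cast hj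
  have h1 : γ - 1 ≠ 0 := by linarith
  rw [levelThreshold, ← Real.rpow_mul (by positivity),
    show 1 / (γ - 1) * (1 - γ) = -1 by field_simp; ring, Real.rpow_neg_one, inv_div,
    Real.rpow_neg hN0.le, div_eq_mul_inv]

lemma one_le_levelThreshold (hγ : 1 < γ) (hj : 1 ≤ j) (hjN : j ≤ N) :
    1 ≤ levelThreshold γ N j := by
  have hj0 : (0 : ℝ) < j := by exact_mod_cast hj
  refine Real.one_le_rpow ?_ (by rw [one_div_nonneg]; linarith)
  rw [one_le_div hj0]
  have hN1 : (1 : ℝ) ≤ N := by exact_mod_cast hj.trans hjN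
  calc (j : ℝ) ≤ N := by exact_mod_cast hjN
    _ ≤ (N : ℝ) ^ γ := Real.self_le_rpow_of_one_le hN1 hγ.le

/-- Below every generation there is a selected one, from which the weights add up to at most
`N ^ (-γ) / (γ - 1)`. -/
lemma exists_mem_selectedLevels (hγ : 1 < γ) (hN : 1 ≤ N) (g : ℕ) :
    ∃ n ∈ selectedLevels γ N, n ≤ g ∧
      ∑ k ∈ Finset.Ioc n g, (k : ℝ) ^ (-γ) ≤ (N : ℝ) ^ (-γ) / (γ - 1) := by
  have hN0 : (0 : ℝ) < N := by exact_mod_cast hN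
  have hγ1 : 0 < γ - 1 := by linarith
  rcases le_or_gt g N with hg | hg
  · refine ⟨g, by simp [selectedLevels]; omega, le_rfl, ?_⟩
    simp only [Finset.Ioc_self, Finset.sum_empty]
    positivity
  have hg0 : (0 : ℝ) < g := by exact_mod_cast (Nat.zero_le N).trans_lt hg
  have hNγ : (0 : ℝ) < (N : ℝ) ^ γ := Real.rpow_pos_of_pos hN0 _
  set z : ℝ := (g : ℝ) ^ (1 - γ) * (N : ℝ) ^ γ with hz
  have hz0 : 0 ≤ z := by positivity
  have hzN : z < N := by
    have : (g : ℝ) ^ (1 - γ) < (N : ℝ) ^ (1 - γ) :=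
      Real.rpow_lt_rpow_of_neg hN0 (by exact_mod_cast hg) (by linarith)
    calc z < (N : ℝ) ^ (1 - γ) * (N : ℝ) ^ γ := mul_lt_mul_of_pos_right this hNγ
      _ = N := by rw [← Real.rpow_add hN0]; simp
  have hinv : (N : ℝ) ^ γ * (N : ℝ) ^ (-γ) = 1 := by
    rw [← Real.rpow_add hN0]; simp
  have hneg : (0 : ℝ) < (N : ℝ) ^ (-γ) := Real.rpow_pos_of_pos hN0 _
  have hgz : (g : ℝ) ^ (1 - γ) = z * (N : ℝ) ^ (-γ) := by rw [hz, mul_assoc, hinv, mul_one]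
  set j := ⌊z⌋₊ + 1 with hj
  have hj1 : 1 ≤ j := by omega
  have hjN : j ≤ N := by
    have := (Nat.floor_lt hz0).2 hzN
    omega
  have hx1 := one_le_levelThreshold hγ hj1 hjN
  have hxpow := levelThreshold_rpow hγ hN hj1
  have hzj : z < j := by rw [hj]; push_cast; exact Nat.lt_floor_add_one z
  have hjz : (j : ℝ) ≤ z + 1 := by
    rw [hj]; push_cast; linarith [Nat.floor_le hz0]
  have hxg : levelThreshold γ N j ≤ g := by
    by_contra! hlt
    have := Real.rpow_lt_rpow_of_neg hg0 hlt (show 1 - γ < 0 by linarith)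
    rw [hxpow, hgz] at this
    nlinarith
  have hn1 : 1 ≤ ⌈levelThreshold γ N j⌉₊ := Nat.one_le_ceil_iff.2 (by linarith)
  have hng : ⌈levelThreshold γ N j⌉₊ ≤ g := Nat.ceil_le.2 hxg
  refine ⟨⌈levelThreshold γ N j⌉₊, ?_, hng, ?_⟩
  · refine Finset.mem_union_right _ (Finset.mem_image_of_mem _ (Finset.mem_Icc.2 ⟨hj1, hjN⟩))
  · refine (Real.sum_Ioc_rpow_neg_le hγ hn1 hng).trans ?_
    gcongr
    have : (⌈levelThreshold γ N j⌉₊ : ℝ) ^ (1 - γ) ≤ levelThreshold γ N j ^ (1 - γ) :=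
      Real.rpow_le_rpow_of_nonpos (by linarith) (Nat.le_ceil _) (by linarith)
    rw [hxpow] at this
    rw [hgz]
    nlinarith

lemma ceil_levelThreshold_rpow_le {H : ℝ} (hH : 0 ≤ H) (hγ : 1 < γ) (hj : 1 ≤ j) (hjN : j ≤ N) :
    (⌈levelThreshold γ N j⌉₊ : ℝ) ^ H ≤
      2 ^ H * ((N : ℝ) ^ (γ * (H / (γ - 1))) * (j : ℝ) ^ (-(H / (γ - 1)))) := by
  have hx1 := one_le_levelThreshold hγ hj hjN
  have hj0 : (0 : ℝ) < j := by exact_mod_cast hj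
  have hN0 : (0 : ℝ) < N := by exact_mod_cast hj.trans hjN
  have hceil : (⌈levelThreshold γ N j⌉₊ : ℝ) ≤ 2 * levelThreshold γ N j := by
    linarith [Nat.ceil_lt_add_one (show 0 ≤ levelThreshold γ N j by linarith)]
  refine (Real.rpow_le_rpow (Nat.cast_nonneg _) hceil hH).trans_eq ?_
  rw [Real.mul_rpow (by norm_num) (by linarith), levelThreshold,
    ← Real.rpow_mul (by positivity), show 1 / (γ - 1) * H = H / (γ - 1) by ring,
    Real.div_rpow (by positivity) hj0.le, ← Real.rpow_mul hN0.le, Real.rpow_neg hj0.le,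
    div_eq_mul_inv ((N : ℝ) ^ (γ * (H / (γ - 1))))]

/-- The number of nodes in the selected generations, when the `n`-th one has at most `c * n ^ H`. -/
lemma sum_selectedLevels_le {H c : ℝ} (hH : 0 ≤ H) (hc : 0 < c) (hγ : 1 < γ) (hN : 1 ≤ N)
    {R : ℕ → ℝ} (hR0 : ∀ n, 0 ≤ R n) (hRzero : R 0 ≤ 1)
    (hR : ∀ n, 1 ≤ n → R n ≤ c * (n : ℝ) ^ H) :
    ∑ n ∈ selectedLevels γ N, R n ≤ (1 + c * 2 ^ H) * ((N : ℝ) ^ (H + 1) +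
      (N : ℝ) ^ (γ * (H / (γ - 1))) * ∑ k ∈ Finset.Icc 1 N, (k : ℝ) ^ (-(H / (γ - 1)))) := by
  classical
  have hN1 : (1 : ℝ) ≤ N := by exact_mod_cast hN
  have hN0 : (0 : ℝ) < N := by linarith
  have h2 : (1 : ℝ) ≤ 2 ^ H := Real.one_le_rpow (by norm_num) hH
  have hpow : (1 : ℝ) ≤ (N : ℝ) ^ (H + 1) := Real.one_le_rpow hN1 (by linarith)
  have hlow : ∑ n ∈ Finset.range (N + 1), R n ≤ 1 + c * (N : ℝ) ^ (H + 1) := by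
    rw [Finset.sum_range_succ']
    have : ∑ n ∈ Finset.range N, R (n + 1) ≤ ∑ _n ∈ Finset.range N, c * (N : ℝ) ^ H := by
      refine Finset.sum_le_sum fun n hn => (hR (n + 1) (by omega)).trans ?_
      have : ((n + 1 : ℕ) : ℝ) ≤ N := by
        exact_mod_cast Nat.succ_le_of_lt (Finset.mem_range.1 hn)
      gcongr
    rw [Finset.sum_const, Finset.card_range, nsmul_eq_mul] at this
    rw [Real.rpow_add_one hN0.ne']
    linarith
  have hhigh : ∑ n ∈ (Finset.Icc 1 N).image (fun j => ⌈levelThreshold γ N j⌉₊), R n ≤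
      c * 2 ^ H * ((N : ℝ) ^ (γ * (H / (γ - 1))) *
        ∑ k ∈ Finset.Icc 1 N, (k : ℝ) ^ (-(H / (γ - 1)))) := by
    refine (Finset.sum_image_le_of_nonneg fun n _ => hR0 n).trans ?_
    rw [Finset.mul_sum, Finset.mul_sum]
    refine Finset.sum_le_sum fun j hj => ?_
    obtain ⟨hj1, hjN⟩ := Finset.mem_Icc.1 hj
    have hx1 := one_le_levelThreshold hγ hj1 hjN
    refine (hR _ (Nat.one_le_ceil_iff.2 (by linarith))).trans ?_
    rw [mul_assoc c]
    exact mul_le_mul_of_nonneg_left (ceil_levelThreshold_rpow_le hH hγ hj1 hjN) hc.le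
  have hunion : ∑ n ∈ selectedLevels γ N, R n ≤ ∑ n ∈ Finset.range (N + 1), R n +
      ∑ n ∈ (Finset.Icc 1 N).image (fun j => ⌈levelThreshold γ N j⌉₊), R n := by
    rw [← Finset.sum_union_inter]
    exact le_add_of_nonneg_right (Finset.sum_nonneg fun n _ => hR0 n)
  have hX : 0 ≤ (N : ℝ) ^ (γ * (H / (γ - 1))) *
      ∑ k ∈ Finset.Icc 1 N, (k : ℝ) ^ (-(H / (γ - 1))) := by positivity
  have hcX : c * (N : ℝ) ^ (H + 1) ≤ c * 2 ^ H * (N : ℝ) ^ (H + 1) := by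
    have : c ≤ c * 2 ^ H := le_mul_of_one_le_right hc.le h2
    gcongr
  linarith

end Levels

/-- For every small `ε` the order covering number is bounded in terms of an integer `N` of
order `ε ^ (-(q / γ))`. -/
lemma IsTree.exists_orderCoveringNumber_le {T : Type} [PartialOrder T] [OrderBot T]
    (htree : IsTree T) {q : ℝ} (hq : 0 < q) {α σ : T → ℝ} (hα : ∀ t, 0 < α t)
    (hσpos : ∀ t, 0 < σ t) (hσmono : Antitone σ) (glb : T → T → T)
    {H c γ : ℝ} (hH : 0 ≤ H) (hc : 0 < c) (hγ : 1 < γ)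
    (hR : ∀ n : ℕ, 1 ≤ n → (Nat.card {t : T | gen t = n} : ℝ) ≤ c * (n : ℝ) ^ H)
    (hw : ∀ t : T, 1 ≤ gen t → α t * σ t ≤ c * (gen t : ℝ) ^ (-(γ / q))) :
    ∃ D ≥ 1, ∀ ε : ℝ, 0 < ε → ε < 1 → ∃ N : ℕ, 1 ≤ N ∧ (N : ℝ) ≤ D * ε ^ (-(q / γ)) ∧
      orderCoveringNumber (treeDist q α σ glb) ε ≤
        ENNReal.ofReal ((1 + c * 2 ^ H) * ((N : ℝ) ^ (H + 1) +
          (N : ℝ) ^ (γ * (H / (γ - 1))) *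
            ∑ k ∈ Finset.Icc 1 N, (k : ℝ) ^ (-(H / (γ - 1))))) := by
  have hγ0 : 0 < γ := by linarith
  have hγ1 : 0 < γ - 1 := by linarith
  have hcq : 0 < c ^ q := Real.rpow_pos_of_pos hc q
  set b : ℝ := (c ^ q / (γ - 1)) ^ (1 / γ) with hb
  have hb0 : 0 < b := by positivity
  refine ⟨b + 1, by linarith, fun ε hε hε1 => ?_⟩
  have hε_pow : 1 ≤ ε ^ (-(q / γ)) :=
    Real.one_le_rpow_of_pos_of_le_one_of_nonpos hε hε1.le (by
      have : 0 < q / γ := by positivity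
      linarith)
  set N := ⌊b * ε ^ (-(q / γ))⌋₊ + 1 with hNdef
  have hlt : b * ε ^ (-(q / γ)) < N := by
    rw [hNdef]; push_cast; exact Nat.lt_floor_add_one _
  have hN : 1 ≤ N := by omega
  have hN0 : (0 : ℝ) < N := by exact_mod_cast hN
  refine ⟨N, hN, ?_, ?_⟩
  · have := Nat.floor_le (show 0 ≤ b * ε ^ (-(q / γ)) by positivity)
    rw [hNdef]; push_cast; linarith
  refine (htree.orderCoveringNumber_le (selectedLevels γ N) ?_).trans
    (ENNReal.ofReal_le_ofReal (sum_selectedLevels_le hH hc hγ hN (fun n => Nat.cast_nonneg _)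
      (by exact_mod_cast htree.card_gen_eq_zero_le) hR))
  intro t
  obtain ⟨n, hn, hnt, hsum⟩ := exists_mem_selectedLevels hγ hN (gen t)
  refine ⟨n, hn, hnt, fun s hst hs => ?_⟩
  subst hs
  have hwq : ∀ r : T, 1 ≤ gen r → (α r * σ r) ^ q ≤ c ^ q * (gen r : ℝ) ^ (-γ) := fun r hr => by
    refine (Real.rpow_le_rpow (mul_pos (hα r) (hσpos r)).le (hw r hr) hq.le).trans_eq ?_
    rw [Real.mul_rpow hc.le (by positivity), ← Real.rpow_mul (Nat.cast_nonneg _),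
      show -(γ / q) * q = -γ by field_simp]
  rw [treeDist, if_pos hst]
  refine (htree.dOrd_le hq hα hσpos hσmono (w := fun n => c ^ q * (n : ℝ) ^ (-γ))
    (fun n => by positivity) hwq s t).trans_lt ?_
  have hNε : c ^ q * ((N : ℝ) ^ (-γ) / (γ - 1)) < ε ^ q := by
    have h1 := Real.rpow_lt_rpow (by positivity) hlt hγ0
    rw [Real.mul_rpow hb0.le (by positivity), hb, ← Real.rpow_mul (by positivity),
      ← Real.rpow_mul hε.le, one_div_mul_cancel hγ0.ne', Real.rpow_one,
      show -(q / γ) * γ = -q by field_simp, Real.rpow_neg hε.le] at h1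
    rw [Real.rpow_neg hN0.le]
    have hNγ : 0 < (N : ℝ) ^ γ := by positivity
    have hεq : 0 < ε ^ q := by positivity
    rw [← div_eq_mul_inv, div_lt_iff₀ hεq] at h1
    calc c ^ q * (((N : ℝ) ^ γ)⁻¹ / (γ - 1)) = c ^ q / (γ - 1) / (N : ℝ) ^ γ := by field_simp
      _ < ε ^ q := by rw [div_lt_iff₀ hNγ]; linarith
  rw [← Finset.mul_sum]
  have hle : c ^ q * ∑ k ∈ Finset.Ioc (gen s) (gen t), (k : ℝ) ^ (-γ) < ε ^ q :=
    (mul_le_mul_of_nonneg_left hsum hcq.le).trans_lt hNε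
  calc _ < (ε ^ q) ^ (1 / q) := Real.rpow_lt_rpow (by positivity) hle (by positivity)
    _ = ε := by rw [← Real.rpow_mul hε.le, mul_one_div_cancel hq.ne', Real.rpow_one]

theorem stmt12 {T : Type} [Countable T] [PartialOrder T] [OrderBot T]
    (htree : IsTree T) (q : ℝ) (hq : 1 < q)
    (α σ : T → ℝ) (hα : ∀ t, 0 < α t) (hσpos : ∀ t, 0 < σ t)
    (hσmono : ∀ ⦃t s : T⦄, t ≤ s → σ s ≤ σ t)
    (K : ℝ) (hK : ∀ s : T, (∑ᶠ r ∈ Set.Iic s, α r ^ q) ^ (1 / q) * σ s ≤ K)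
    (glb : T → T → T) (hglb : IsGCA glb)
    (H c γ : ℝ) (hH : 0 ≤ H) (hc : 0 < c) (hγ : 1 < γ)
    (hR : ∀ n : ℕ, 1 ≤ n → (Nat.card {t : T | gen t = n} : ℝ) ≤ c * (n : ℝ) ^ H)
    (hw : ∀ t : T, 1 ≤ gen t → α t * σ t ≤ c * (gen t : ℝ) ^ (-(γ / q))) :
    ∃ C > 0, ∃ ε₀ > 0, ∀ ε : ℝ, 0 < ε → ε < ε₀ →
      (γ < H + 1 → orderCoveringNumber (treeDist q α σ glb) ε ≤
        ENNReal.ofReal (C * ε ^ (-(q * H / (γ - 1))))) ∧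
      (γ = H + 1 → orderCoveringNumber (treeDist q α σ glb) ε ≤
        ENNReal.ofReal (C * ε ^ (-q) * Real.log (1 / ε))) ∧
      (H + 1 < γ → orderCoveringNumber (treeDist q α σ glb) ε ≤
        ENNReal.ofReal (C * ε ^ (-(q * (H + 1) / γ)))) := by
  have hq0 : 0 < q := by linarith
  have hγ0 : 0 < γ := by linarith
  have hγ1 : 0 < γ - 1 := by linarith
  obtain ⟨D, hD, hcover⟩ := htree.exists_orderCoveringNumber_le hq0 hα hσpos
    (fun _ _ hab => hσmono hab) glb hH hc hγ hR hw
  have hD0 : 0 < D := by linarith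
  have hpow : ∀ {N : ℕ} {ε e : ℝ}, 0 < ε → 0 ≤ e → (N : ℝ) ≤ D * ε ^ (-(q / γ)) →
      (N : ℝ) ^ e ≤ D ^ e * ε ^ (-(q * e / γ)) := fun {N ε e} hε he hN => by
    refine (Real.rpow_le_rpow (Nat.cast_nonneg N) hN he).trans_eq ?_
    rw [Real.mul_rpow hD0.le (by positivity), ← Real.rpow_mul hε.le]
    congr 2
    ring
  set M : ℝ := 1 + c * 2 ^ H with hM
  have hM0 : 0 < M := by positivity
  set p : ℝ := H / (γ - 1) with hp
  have hp0 : 0 ≤ p := by positivity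
  rcases lt_trichotomy γ (H + 1) with hcase | hcase | hcase
  · have hp1 : 1 < p := by rw [hp, one_lt_div hγ1]; linarith
    obtain ⟨B, hB, hsum⟩ := Real.exists_sum_Icc_rpow_neg_le hp1
    refine ⟨M * (1 + B) * D ^ (γ * p), by positivity, 1, one_pos, fun ε hε hε1 =>
      ⟨fun _ => ?_, fun h => absurd h hcase.ne, fun h => absurd h hcase.not_gt⟩⟩
    obtain ⟨N, hN, hND, hle⟩ := hcover ε hε hε1
    refine hle.trans (ENNReal.ofReal_le_ofReal ?_)
    have hN1 : (1 : ℝ) ≤ N := by exact_mod_cast hN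
    have hexp : H + 1 ≤ γ * p := by
      rw [hp, ← mul_div_assoc, le_div_iff₀ hγ1]
      nlinarith
    have h1 : (N : ℝ) ^ (H + 1) ≤ (N : ℝ) ^ (γ * p) := Real.rpow_le_rpow_of_exponent_le hN1 hexp
    have h2 := hpow hε (show 0 ≤ γ * p by positivity) hND
    rw [show q * (γ * p) / γ = q * H / (γ - 1) by rw [hp]; field_simp] at h2
    calc _ ≤ M * ((N : ℝ) ^ (γ * p) + (N : ℝ) ^ (γ * p) * B) := by
          gcongr
          exact hsum N
      _ = M * (1 + B) * (N : ℝ) ^ (γ * p) := by ring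
      _ ≤ M * (1 + B) * (D ^ (γ * p) * ε ^ (-(q * H / (γ - 1)))) := by gcongr
      _ = _ := by ring
  · have hp1 : p = 1 := by rw [hp, div_eq_one_iff_eq hγ1.ne']; linarith
    have hlogD : 0 ≤ Real.log D := Real.log_nonneg hD
    refine ⟨M * (2 + Real.log D + q / γ) * D ^ γ, by positivity, Real.exp (-1), Real.exp_pos _,
      fun ε hε hε1 =>
      ⟨fun h => absurd h hcase.not_lt, fun _ => ?_, fun h => absurd h hcase.not_gt⟩⟩
    obtain ⟨N, hN, hND, hle⟩ := hcover ε hε (hε1.trans (Real.exp_lt_one_iff.2 (by norm_num)))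
    refine hle.trans (ENNReal.ofReal_le_ofReal ?_)
    have hN0 : (0 : ℝ) < N := by exact_mod_cast hN
    have hlog : 1 ≤ Real.log (1 / ε) := by
      rw [one_div, Real.log_inv]
      have := (Real.log_lt_iff_lt_exp hε).2 hε1
      linarith
    have hlogN : Real.log N ≤ Real.log D + q / γ * Real.log (1 / ε) := by
      refine (Real.log_le_log hN0 hND).trans_eq ?_
      rw [Real.log_mul hD0.ne' (by positivity), Real.log_rpow hε, one_div, Real.log_inv]
      ring
    have hlogN0 : 0 ≤ Real.log N := Real.log_nonneg (by exact_mod_cast hN)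
    have h2 := hpow hε hγ0.le hND
    rw [show q * γ / γ = q by field_simp] at h2
    have hsum := Real.sum_Icc_rpow_neg_one_le N
    rw [hp1, mul_one, ← hcase]
    calc _ ≤ M * ((N : ℝ) ^ γ + (N : ℝ) ^ γ * (1 + Real.log N)) := by gcongr
      _ = M * ((N : ℝ) ^ γ * (2 + Real.log N)) := by ring
      _ ≤ M * (D ^ γ * ε ^ (-q) * ((2 + Real.log D + q / γ) * Real.log (1 / ε))) := by
          gcongr
          nlinarith
      _ = _ := by ring
  · have hp1 : p < 1 := by rw [hp, div_lt_one hγ1]; linarith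
    have hp1' : 0 < 1 - p := by linarith
    refine ⟨M * (1 + 1 / (1 - p)) * D ^ (H + 1), by positivity, 1, one_pos, fun ε hε hε1 =>
      ⟨fun h => absurd h hcase.not_gt, fun h => absurd h hcase.ne', fun _ => ?_⟩⟩
    obtain ⟨N, hN, hND, hle⟩ := hcover ε hε hε1
    refine hle.trans (ENNReal.ofReal_le_ofReal ?_)
    have hN0 : (0 : ℝ) < N := by exact_mod_cast hN
    have hadd : (N : ℝ) ^ (γ * p) * (N : ℝ) ^ (1 - p) = (N : ℝ) ^ (H + 1) := by
      rw [← Real.rpow_add hN0]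
      congr 1
      rw [hp]
      field_simp
      ring
    have h2 := hpow hε (show 0 ≤ H + 1 by linarith) hND
    calc _ ≤ M * ((N : ℝ) ^ (H + 1) + (N : ℝ) ^ (γ * p) * ((N : ℝ) ^ (1 - p) / (1 - p))) := by
          gcongr
          exact Real.sum_Icc_rpow_neg_le_of_lt_one hp0 hp1 N
      _ = M * (1 + 1 / (1 - p)) * (N : ℝ) ^ (H + 1) := by rw [← mul_div_assoc, hadd]; ring
      _ ≤ M * (1 + 1 / (1 - p)) * (D ^ (H + 1) * ε ^ (-(q * (H + 1) / γ))) := by gcongr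
      _ = _ := by ring
end
end
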